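/- Assume there is ε ∈ (0,1) with ‖K* − K̄‖_F ≤ (ε/2)·√(λ_min(Γ)) / (√(λ_min(Γ))·‖S B_a‖_F + ‖S B_u‖_F), let L > 0 be a Lipschitz constant of ∇J̃ on S₀, and assume 0 < ω < (2/L)·λ_min(Γ⁻¹)/λ_max(Γ⁻¹)². Then for every i ∈ ℕ the iterate Λ^i belongs to S₀; in particular, at every step the stabilizing solution P_u(Λ^i) exists and the Lyapunov equation defining Π(Λ^i) has a unique symmetric solution, so the iteration is well defined for all i. -/

import Mathlib

open Matrix Filter Topology

noncomputable section

/-- A real square matrix is Hurwitz if every complex eigenvalue has strictly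
negative real part. -/
def IsHurwitz {N : ℕ} (M : Matrix (Fin N) (Fin N) ℝ) : Prop :=
  ∀ μ : ℂ, μ ∈ spectrum ℂ (M.map (algebraMap ℝ ℂ)) → μ.re < 0

/-- Frobenius norm of a real matrix. -/
def frobNorm {p q : ℕ} (M : Matrix (Fin p) (Fin q) ℝ) : ℝ :=
  Real.sqrt (Matrix.trace (Mᵀ * M))

/-- Minimal eigenvalue of a (Hermitian) real matrix. -/
def eigMin {m : ℕ} (M : Matrix (Fin m) (Fin m) ℝ) : ℝ :=
  if hM : M.IsHermitian then ⨅ i, hM.eigenvalues i else 0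

/-- Maximal eigenvalue of a (Hermitian) real matrix. -/
def eigMax {m : ℕ} (M : Matrix (Fin m) (Fin m) ℝ) : ℝ :=
  if hM : M.IsHermitian then ⨆ i, hM.eigenvalues i else 0

variable {n m_u m_a : ℕ}

/-- `P` is the stabilizing solution of the spoofed ARE for the gain `Λ`. -/
def IsStabSol (A : Matrix (Fin n) (Fin n) ℝ) (Bu : Matrix (Fin n) (Fin m_u) ℝ)
    (Ba : Matrix (Fin n) (Fin m_a) ℝ) (Q : Matrix (Fin n) (Fin n) ℝ)
    (R : Matrix (Fin m_a) (Fin m_a) ℝ)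
    (Λ : Matrix (Fin m_u) (Fin n) ℝ) (P : Matrix (Fin n) (Fin n) ℝ) : Prop :=
  P.PosDef ∧
  (A + Bu * Λ)ᵀ * P + P * (A + Bu * Λ) + Q + P * Ba * R⁻¹ * Baᵀ * P = 0 ∧
  IsHurwitz (A + Bu * Λ + Ba * R⁻¹ * Baᵀ * P)

/-- `Pim` is a symmetric solution of the Lyapunov equation defining `Π(Λ)`,
given the stabilizing ARE solution `P = P_u(Λ)`. -/
def IsLyapSol (A : Matrix (Fin n) (Fin n) ℝ) (Bu : Matrix (Fin n) (Fin m_u) ℝ)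
    (Ba : Matrix (Fin n) (Fin m_a) ℝ) (R : Matrix (Fin m_a) (Fin m_a) ℝ)
    (Kbar : Matrix (Fin m_a) (Fin n) ℝ)
    (Λ : Matrix (Fin m_u) (Fin n) ℝ) (P Pim : Matrix (Fin n) (Fin n) ℝ) : Prop :=
  Pim.IsHermitian ∧
  (A + Bu * Λ + Ba * R⁻¹ * Baᵀ * P) * Pim + Pim * (A + Bu * Λ + Ba * R⁻¹ * Baᵀ * P)ᵀ
    - Kbarᵀ * R⁻¹ * Baᵀ - Ba * R⁻¹ * Kbar
    + P * Ba * (R⁻¹ * R⁻¹) * Baᵀ + Ba * (R⁻¹ * R⁻¹) * Baᵀ * P = 0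

/-- The deception cost `J̃(Λ)`, expressed through a choice function `Pu` for the
stabilizing solution of the spoofed ARE. -/
def Jcost (Ba : Matrix (Fin n) (Fin m_a) ℝ) (R : Matrix (Fin m_a) (Fin m_a) ℝ)
    (Γ : Matrix (Fin m_u) (Fin m_u) ℝ) (Kbar : Matrix (Fin m_a) (Fin n) ℝ)
    (Pu : Matrix (Fin m_u) (Fin n) ℝ → Matrix (Fin n) (Fin n) ℝ)
    (Λ : Matrix (Fin m_u) (Fin n) ℝ) : ℝ :=
  frobNorm (R⁻¹ * Baᵀ * Pu Λ - Kbar) ^ 2 + Matrix.trace (Λᵀ * Γ * Λ)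

/-- The sublevel set `S₀`. -/
def S0 (A : Matrix (Fin n) (Fin n) ℝ) (Bu : Matrix (Fin n) (Fin m_u) ℝ)
    (Ba : Matrix (Fin n) (Fin m_a) ℝ) (Q : Matrix (Fin n) (Fin n) ℝ)
    (R : Matrix (Fin m_a) (Fin m_a) ℝ) (Γ : Matrix (Fin m_u) (Fin m_u) ℝ)
    (Kbar : Matrix (Fin m_a) (Fin n) ℝ)
    (Pu : Matrix (Fin m_u) (Fin n) ℝ → Matrix (Fin n) (Fin n) ℝ) :
    Set (Matrix (Fin m_u) (Fin n) ℝ) :=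
  {Λ | (∃ P, IsStabSol A Bu Ba Q R Λ P) ∧
    Jcost Ba R Γ Kbar Pu Λ ≤ Jcost Ba R Γ Kbar Pu 0}

/-- A quadratic equation in a finite-dimensional algebra, depending affinely on a real parameter,
can be solved locally as soon as its linearization is injective. -/
lemma exists_hasDerivAt_quadratic_solution {𝔸 : Type*} [NormedRing 𝔸] [NormedAlgebra ℝ 𝔸]
    [FiniteDimensional ℝ 𝔸] (a b e h q g p : 𝔸)
    (hp : a * p + p * e + q + p * g * p = 0)
    (hinj : ∀ x, (a + p * g) * x + x * (e + g * p) = 0 → x = 0) :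
    ∃ (φ : ℝ → 𝔸) (x : 𝔸), φ 0 = p ∧ HasDerivAt φ x 0 ∧
      (a + p * g) * x + x * (e + g * p) + b * p + p * h = 0 ∧
      ∀ᶠ t in 𝓝 (0 : ℝ), (a + t • b) * φ t + φ t * (e + t • h) + q + φ t * g * φ t = 0 := by
  have : CompleteSpace 𝔸 := FiniteDimensional.complete ℝ 𝔸
  set f : ℝ × 𝔸 → 𝔸 := fun v =>
    (a + v.1 • b) * v.2 + v.2 * (e + v.1 • h) + q + v.2 * g * v.2 with hf
  have hfC : ContDiff ℝ 1 f := by fun_prop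
  have hstrict : HasStrictFDerivAt f (fderiv ℝ f (0, p)) (0, p) :=
    hfC.contDiffAt.hasStrictFDerivAt one_ne_zero
  have hd : ∀ (τ : ℝ) (x : 𝔸), fderiv ℝ f (0, p) (τ, x) =
      (a + p * g) * x + x * (e + g * p) + τ • (b * p + p * h) := by
    intro τ x
    have hline : HasDerivAt (fun s : ℝ => ((0 : ℝ), p) + s • (τ, x)) (τ, x) 0 := by
      simpa using ((hasDerivAt_id (0 : ℝ)).smul_const (τ, x)).const_add ((0 : ℝ), p)
    have h1 := HasFDerivAt.comp_hasDerivAt_of_eq (0 : ℝ) hstrict.hasFDerivAt hline (by simp)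
    have hτ : HasDerivAt (fun s : ℝ => s * τ) τ 0 := by
      simpa using (hasDerivAt_id (0 : ℝ)).mul_const τ
    have hx : HasDerivAt (fun s : ℝ => p + s • x) x 0 := by
      simpa using ((hasDerivAt_id (0 : ℝ)).smul_const x).const_add p
    have h2 : HasDerivAt (fun s : ℝ => (a + (s * τ) • b) * (p + s • x)
        + (p + s • x) * (e + (s * τ) • h) + q + (p + s • x) * g * (p + s • x)) _ 0 :=
      (((((hτ.smul_const b).const_add a).mul hx).add
        (hx.mul ((hτ.smul_const h).const_add e))).add_const q).add ((hx.mul_const g).mul hx)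
    have h3 := h1.unique (h2.congr_of_eventuallyEq (by
      filter_upwards with s
      simp [hf, Function.comp]))
    rw [h3]
    simp only [zero_mul, zero_smul, add_zero, smul_add, mul_add, add_mul, smul_mul_assoc,
      mul_smul_comm]
    noncomm_ring
  have hinv : (fderiv ℝ f (0, p) ∘L .inr ℝ ℝ 𝔸).IsInvertible := by
    have hi : Function.Injective ((fderiv ℝ f (0, p) ∘L .inr ℝ ℝ 𝔸 : 𝔸 →L[ℝ] 𝔸) : 𝔸 →ₗ[ℝ] 𝔸) := by
      rw [← LinearMap.ker_eq_bot, LinearMap.ker_eq_bot']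
      intro x hx
      apply hinj
      simpa [hd] using hx
    refine ⟨(LinearEquiv.ofInjectiveEndo _ hi).toContinuousLinearEquiv, ?_⟩
    ext x
    simp
  set φ := hstrict.implicitFunctionOfProdDomain hinv with hφ
  have hφd : HasDerivAt φ _ (0 : ℝ) :=
    (hstrict.hasStrictFDerivAt_implicitFunctionOfProdDomain hinv).hasFDerivAt.hasDerivAt
  have hφ0 : φ 0 = p :=
    (hstrict.eventually_apply_eq_iff_implicitFunctionOfProdDomain hinv).self_of_nhds.mp rfl
  have hf0 : f (0, p) = 0 := by simpa [hf] using hp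
  have hev : ∀ᶠ t in 𝓝 (0 : ℝ), f (t, φ t) = 0 := by
    simpa only [hf0] using hstrict.eventually_apply_implicitFunctionOfProdDomain hinv
  refine ⟨φ, _, hφ0, hφd, ?_, hev⟩
  have h1 := HasFDerivAt.comp_hasDerivAt_of_eq (0 : ℝ) hstrict.hasFDerivAt
    ((hasDerivAt_id (0 : ℝ)).prodMk hφd) (by simp [hφ0])
  have h2 := h1.unique ((hasDerivAt_const (0 : ℝ) (0 : 𝔸)).congr_of_eventuallyEq hev)
  rw [hd, one_smul] at h2
  rw [← h2]
  abel

/-- A Sylvester equation whose two coefficients have disjoint spectra has only the zero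
solution. -/
lemma Matrix.eq_zero_of_mul_eq_mul {N : ℕ} (M₁ M₂ X : Matrix (Fin N) (Fin N) ℂ)
    (hdisj : ∀ μ ∈ spectrum ℂ M₁, μ ∉ spectrum ℂ M₂) (hX : M₁ * X = X * M₂) : X = 0 := by
  rcases Nat.eq_zero_or_pos N with rfl | hN
  · exact Subsingleton.elim _ _
  have : Nonempty (Fin N) := ⟨⟨0, hN⟩⟩
  have hpow : ∀ p : Polynomial ℂ, Polynomial.aeval M₁ p * X = X * Polynomial.aeval M₂ p := by
    intro p
    have h : SemiconjBy X M₂ M₁ := hX.symm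
    induction p using Polynomial.induction_on' with
    | add p q hp hq => simp only [map_add, add_mul, mul_add, hp, hq]
    | monomial k c =>
      simp only [Polynomial.aeval_monomial]
      rw [mul_assoc, ← (h.pow_right k).eq, ← mul_assoc, Algebra.commutes, mul_assoc,
        Algebra.commutes]
  have h0 := hpow M₂.charpoly
  rw [Matrix.aeval_self_charpoly, mul_zero] at h0
  have hunit : IsUnit (Polynomial.aeval M₁ M₂.charpoly) := by
    rw [← spectrum.zero_notMem_iff ℂ,
      spectrum.map_polynomial_aeval_of_nonempty _ _
        (spectrum.nonempty_of_isAlgClosed_of_finiteDimensional ℂ M₁)]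
    rintro ⟨μ, hμ, hev⟩
    exact hdisj μ hμ (Matrix.mem_spectrum_iff_isRoot_charpoly.mpr hev)
  exact (hunit.mul_right_eq_zero).mp h0

lemma IsHurwitz.sylvester_eq_zero {N : ℕ} {M₁ M₂ X : Matrix (Fin N) (Fin N) ℝ}
    (h₁ : IsHurwitz M₁) (h₂ : IsHurwitz M₂) (hX : M₁ᵀ * X + X * M₂ = 0) : X = 0 := by
  set c : Matrix (Fin N) (Fin N) ℝ → Matrix (Fin N) (Fin N) ℂ :=
    fun M => M.map (algebraMap ℝ ℂ) with hc
  have hcX : c X = 0 := by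
    apply Matrix.eq_zero_of_mul_eq_mul (-(c M₁)ᵀ) (c M₂)
    · intro μ hμ hμ₂
      have h3 : -μ ∈ spectrum ℂ (c M₁) := by
        rw [← spectrum.neg_eq, Set.mem_neg] at hμ
        rw [Matrix.mem_spectrum_iff_isRoot_charpoly] at hμ ⊢
        rwa [Matrix.charpoly_transpose] at hμ
      have h4 := h₁ _ h3
      have h5 := h₂ _ hμ₂
      simp only [Complex.neg_re] at h4
      linarith
    · have h6 : c (M₁ᵀ * X + X * M₂) = 0 := by rw [hX]; ext; simp [hc]
      have h7 : c (M₁ᵀ * X + X * M₂) = (c M₁)ᵀ * c X + c X * c M₂ := by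
        simp only [hc, ← Matrix.transpose_map, ← Matrix.map_mul]
        ext; simp
      rw [h7] at h6
      rw [neg_mul, neg_eq_iff_add_eq_zero, h6]
  ext i j
  simpa [hc] using congrFun (congrFun hcX i) j

lemma dotProduct_mulVec_comm_of_isHermitian {N : ℕ} {S : Matrix (Fin N) (Fin N) ℝ}
    (hS : S.IsHermitian) (u w : Fin N → ℝ) : u ⬝ᵥ S *ᵥ w = w ⬝ᵥ S *ᵥ u := by
  have h : Sᵀ = S := by simpa using hS.eq
  rw [dotProduct_mulVec, ← mulVec_transpose, dotProduct_comm, h]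

lemma dotProduct_lyapunov_mulVec {N : ℕ} {S : Matrix (Fin N) (Fin N) ℝ} (hS : S.IsHermitian)
    (M : Matrix (Fin N) (Fin N) ℝ) (u : Fin N → ℝ) :
    u ⬝ᵥ (Mᵀ * S + S * M) *ᵥ u = 2 * (u ⬝ᵥ S *ᵥ (M *ᵥ u)) := by
  rw [add_mulVec, dotProduct_add, ← mulVec_mulVec, ← mulVec_mulVec, dotProduct_mulVec u Mᵀ,
    vecMul_transpose, dotProduct_mulVec_comm_of_isHermitian hS (M *ᵥ u)]
  ring

lemma isHermitian_lyapunov {N : ℕ} {S : Matrix (Fin N) (Fin N) ℝ} (hS : S.IsHermitian)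
    (M : Matrix (Fin N) (Fin N) ℝ) : (-(Mᵀ * S + S * M)).IsHermitian := by
  have h : Sᵀ = S := by simpa using hS.eq
  rw [IsHermitian, conjTranspose_eq_transpose_of_trivial, transpose_neg, transpose_add,
    transpose_mul, transpose_mul, transpose_transpose, h, add_comm]

/-- The Lyapunov criterion: a quadratic Lyapunov function certifies that a matrix is Hurwitz. -/
lemma IsHurwitz.of_lyapunov {N : ℕ} {M S : Matrix (Fin N) (Fin N) ℝ} (hS : S.PosDef)
    (h : (-(Mᵀ * S + S * M)).PosDef) : IsHurwitz M := by
  intro μ hμ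
  rw [← Matrix.spectrum_toLin', ← Module.End.hasEigenvalue_iff_mem_spectrum] at hμ
  obtain ⟨v, hv⟩ := hμ.exists_hasEigenvector
  have hv0 := hv.2
  have hMv : M.map (algebraMap ℝ ℂ) *ᵥ v = μ • v := by simpa using hv.apply_eq_smul
  set x : Fin N → ℝ := fun i => (v i).re with hx
  set y : Fin N → ℝ := fun i => (v i).im with hy
  have hMx : M *ᵥ x = μ.re • x - μ.im • y := by
    ext i
    have := congrArg Complex.re (congrFun hMv i)
    simpa [mulVec, dotProduct, hx, hy] using this
  have hMy : M *ᵥ y = μ.re • y + μ.im • x := by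
    ext i
    have := congrArg Complex.im (congrFun hMv i)
    simpa [mulVec, dotProduct, hx, hy] using this
  have hsum : x ⬝ᵥ (-(Mᵀ * S + S * M)) *ᵥ x + y ⬝ᵥ (-(Mᵀ * S + S * M)) *ᵥ y =
      -(2 * μ.re * (x ⬝ᵥ S *ᵥ x + y ⬝ᵥ S *ᵥ y)) := by
    rw [neg_mulVec, neg_mulVec, dotProduct_neg, dotProduct_neg, dotProduct_lyapunov_mulVec hS.1,
      dotProduct_lyapunov_mulVec hS.1, hMx, hMy]
    simp only [mulVec_sub, mulVec_add, mulVec_smul, dotProduct_sub, dotProduct_add,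
      dotProduct_smul, smul_eq_mul]
    rw [dotProduct_mulVec_comm_of_isHermitian hS.1 y x]
    ring
  have hxy : x ≠ 0 ∨ y ≠ 0 := by
    by_contra! hcon
    apply hv0
    ext i
    exact Complex.ext (congrFun hcon.1 i) (congrFun hcon.2 i)
  have nn : ∀ {T : Matrix (Fin N) (Fin N) ℝ}, T.PosDef → ∀ u, 0 ≤ u ⬝ᵥ T *ᵥ u := fun hT u => by
    simpa using hT.posSemidef.dotProduct_mulVec_nonneg u
  have pp : ∀ {T : Matrix (Fin N) (Fin N) ℝ}, T.PosDef → 0 < x ⬝ᵥ T *ᵥ x + y ⬝ᵥ T *ᵥ y := by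
    intro T hT
    rcases hxy with h | h
    · exact add_pos_of_pos_of_nonneg (by simpa using hT.dotProduct_mulVec_pos h) (nn hT y)
    · exact add_pos_of_nonneg_of_pos (nn hT x) (by simpa using hT.dotProduct_mulVec_pos h)
  have h1 := pp h
  have h2 := pp hS
  rw [hsum] at h1
  by_contra! hμ0
  nlinarith [mul_nonneg hμ0 h2.le]

lemma Matrix.posDef_of_pos_on_sphere {N : ℕ} {M : Matrix (Fin N) (Fin N) ℝ} (hM : M.IsHermitian)
    (h : ∀ x ∈ Metric.sphere (0 : Fin N → ℝ) 1, 0 < x ⬝ᵥ M *ᵥ x) : M.PosDef := by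
  refine .of_dotProduct_mulVec_pos hM fun {x} hx => ?_
  have hx' : ‖x‖ ≠ 0 := norm_ne_zero_iff.mpr hx
  have h1 := h (‖x‖⁻¹ • x) (by simp [norm_smul, hx'])
  simp only [mulVec_smul, dotProduct_smul, smul_dotProduct, smul_eq_mul] at h1
  rw [star_trivial]
  have h2 : x ⬝ᵥ M *ᵥ x = ‖x‖ ^ 2 * (‖x‖⁻¹ * (‖x‖⁻¹ * (x ⬝ᵥ M *ᵥ x))) := by field_simp
  rw [h2]
  positivity

/-- Positive definiteness is an open condition among Hermitian matrices. -/
lemma Matrix.PosDef.eventually {N : ℕ} {ι : Type*} {l : Filter ι}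
    {f : ι → Matrix (Fin N) (Fin N) ℝ} {M : Matrix (Fin N) (Fin N) ℝ} (hM : M.PosDef)
    (hf : Tendsto f l (𝓝 M)) (hherm : ∀ᶠ i in l, (f i).IsHermitian) :
    ∀ᶠ i in l, (f i).PosDef := by
  have h : ∀ᶠ T in 𝓝 M, ∀ x ∈ Metric.sphere (0 : Fin N → ℝ) 1, 0 < x ⬝ᵥ T *ᵥ x := by
    refine (isCompact_sphere (0 : Fin N → ℝ) 1).eventually_forall_of_forall_eventually
      fun x hx => ?_
    have hc : Continuous fun z : Matrix (Fin N) (Fin N) ℝ × (Fin N → ℝ) => z.2 ⬝ᵥ z.1 *ᵥ z.2 := by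
      fun_prop
    refine hc.continuousAt.eventually (lt_mem_nhds ?_)
    have hx0 : x ≠ 0 := fun h => by simp [h] at hx
    simpa using hM.dotProduct_mulVec_pos hx0
  filter_upwards [hf.eventually h, hherm] with i h1 h2
  exact Matrix.posDef_of_pos_on_sphere h2 h1

/-- The largest generalized eigenvalue of a symmetric pencil `(P, S)` is attained. -/
lemma Matrix.PosDef.exists_generalized_eigenvector {N : ℕ} (hN : 0 < N)
    {P S : Matrix (Fin N) (Fin N) ℝ} (hP : P.IsHermitian) (hS : S.PosDef) :
    ∃ (c : ℝ) (v : Fin N → ℝ), v ≠ 0 ∧ P *ᵥ v = c • (S *ᵥ v) ∧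
      ∀ x, x ⬝ᵥ P *ᵥ x ≤ c * (x ⬝ᵥ S *ᵥ x) := by
  have : Nonempty (Fin N) := ⟨⟨0, hN⟩⟩
  have hpos : ∀ x : Fin N → ℝ, x ≠ 0 → 0 < x ⬝ᵥ S *ᵥ x := fun x hx => by
    simpa using hS.dotProduct_mulVec_pos hx
  have hcont : ContinuousOn (fun x : Fin N → ℝ => (x ⬝ᵥ P *ᵥ x) / (x ⬝ᵥ S *ᵥ x))
      (Metric.sphere 0 1) := by
    refine ContinuousOn.div (by fun_prop) (by fun_prop) fun x hx => ?_
    exact (hpos x fun h => by simp [h] at hx).ne'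
  obtain ⟨v, hv, hmax⟩ := (isCompact_sphere (0 : Fin N → ℝ) 1).exists_isMaxOn
    (NormedSpace.sphere_nonempty.mpr zero_le_one) hcont
  have hv0 : v ≠ 0 := fun h => by simp [h] at hv
  set c := (v ⬝ᵥ P *ᵥ v) / (v ⬝ᵥ S *ᵥ v) with hc
  have hle : ∀ x, x ⬝ᵥ P *ᵥ x ≤ c * (x ⬝ᵥ S *ᵥ x) := by
    intro x
    rcases eq_or_ne x 0 with rfl | hx
    · simp
    have hx' : ‖x‖ ≠ 0 := norm_ne_zero_iff.mpr hx
    have h1 : (‖x‖⁻¹ • x) ∈ Metric.sphere (0 : Fin N → ℝ) 1 := by simp [norm_smul, hx']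
    have h2 := hmax h1
    simp only [Set.mem_ofPred_eq, mulVec_smul, dotProduct_smul, smul_dotProduct, smul_eq_mul] at h2
    rw [mul_div_mul_left _ _ (inv_ne_zero hx'), mul_div_mul_left _ _ (inv_ne_zero hx'),
      div_le_iff₀ (hpos x hx)] at h2
    exact h2
  refine ⟨c, v, hv0, ?_, hle⟩
  have hpsd : (c • S - P).PosSemidef := by
    refine .of_dotProduct_mulVec_nonneg ?_ fun x => ?_
    · exact (IsSelfAdjoint.smul (.all c) hS.1).sub hP
    · simpa [sub_mulVec, smul_mulVec] using hle x
  have h0 := (hpsd.dotProduct_mulVec_zero_iff v).mp (by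
    simp [sub_mulVec, smul_mulVec, hc, div_mul_cancel₀ _ (hpos v hv0).ne'])
  rw [sub_mulVec, smul_mulVec, sub_eq_zero] at h0
  exact h0.symm

lemma trace_transpose_mul_eq_sum {p q : ℕ} (X Y : Matrix (Fin p) (Fin q) ℝ) :
    trace (Xᵀ * Y) = ∑ i, ∑ j, X i j * Y i j := by
  rw [Finset.sum_comm]
  simp [trace, mul_apply]

lemma frobNorm_nonneg {p q : ℕ} (M : Matrix (Fin p) (Fin q) ℝ) : 0 ≤ frobNorm M :=
  Real.sqrt_nonneg _

lemma trace_transpose_mul_self_nonneg {p q : ℕ} (M : Matrix (Fin p) (Fin q) ℝ) :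
    0 ≤ trace (Mᵀ * M) := by
  rw [trace_transpose_mul_eq_sum]
  exact Finset.sum_nonneg fun i _ => Finset.sum_nonneg fun j _ => mul_self_nonneg _

lemma frobNorm_sq {p q : ℕ} (M : Matrix (Fin p) (Fin q) ℝ) :
    frobNorm M ^ 2 = trace (Mᵀ * M) :=
  Real.sq_sqrt (trace_transpose_mul_self_nonneg M)

lemma frobNorm_eq_zero {p q : ℕ} {M : Matrix (Fin p) (Fin q) ℝ} (h : frobNorm M = 0) : M = 0 := by
  have h1 := frobNorm_sq M
  rw [h, zero_pow two_ne_zero] at h1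
  have h2 : trace (Mᴴ * M) = 0 := by simpa using h1.symm
  exact trace_conjTranspose_mul_self_eq_zero_iff.mp h2

lemma frobNorm_neg {p q : ℕ} (M : Matrix (Fin p) (Fin q) ℝ) : frobNorm (-M) = frobNorm M := by
  simp [frobNorm]

lemma frobNorm_smul {p q : ℕ} {c : ℝ} (hc : 0 ≤ c) (M : Matrix (Fin p) (Fin q) ℝ) :
    frobNorm (c • M) = c * frobNorm M := by
  rw [frobNorm, frobNorm, transpose_smul, Matrix.smul_mul, Matrix.mul_smul, smul_smul, trace_smul,
    smul_eq_mul, Real.sqrt_mul (mul_self_nonneg c), Real.sqrt_mul_self hc]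

lemma trace_transpose_mul_le {p q : ℕ} (X Y : Matrix (Fin p) (Fin q) ℝ) :
    trace (Xᵀ * Y) ≤ frobNorm X * frobNorm Y := by
  rw [frobNorm, frobNorm, trace_transpose_mul_eq_sum, trace_transpose_mul_eq_sum,
    trace_transpose_mul_eq_sum]
  simp only [← Fintype.sum_prod_type']
  simpa [pow_two] using Real.sum_mul_le_sqrt_mul_sqrt Finset.univ
    (fun x : Fin p × Fin q => X x.1 x.2) (fun x => Y x.1 x.2)

lemma dotProduct_mulVec_le_frobNorm {p : ℕ} (M : Matrix (Fin p) (Fin p) ℝ) (x : Fin p → ℝ) :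
    x ⬝ᵥ M *ᵥ x ≤ frobNorm M * (x ⬝ᵥ x) := by
  have h1 := trace_transpose_mul_le M (vecMulVec x x)
  have h2 : trace (Mᵀ * vecMulVec x x) = x ⬝ᵥ M *ᵥ x := by
    rw [trace_transpose_mul_eq_sum]
    simp only [vecMulVec_apply, dotProduct, mulVec, Finset.mul_sum]
    exact Finset.sum_congr rfl fun i _ => Finset.sum_congr rfl fun j _ => by ring
  have h3 : frobNorm (vecMulVec x x) = x ⬝ᵥ x := by
    rw [frobNorm, transpose_vecMulVec, vecMulVec_mul_vecMulVec, trace_vecMulVec,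
      dotProduct_smul, smul_eq_mul, Real.sqrt_mul_self (by simpa using dotProduct_star_self_nonneg x)]
  rwa [h2, h3] at h1

section
attribute [local instance] Matrix.frobeniusNormedAddCommGroup

lemma frobNorm_eq_norm {p q : ℕ} (M : Matrix (Fin p) (Fin q) ℝ) : frobNorm M = ‖M‖ := by
  rw [frobNorm, trace_transpose_mul_eq_sum, frobenius_norm_def, Real.sqrt_eq_rpow]
  simp [pow_two]

lemma frobNorm_add_le {p q : ℕ} (X Y : Matrix (Fin p) (Fin q) ℝ) :
    frobNorm (X + Y) ≤ frobNorm X + frobNorm Y := by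
  simpa only [frobNorm_eq_norm] using norm_add_le X Y

lemma frobNorm_sub_le {p q : ℕ} (X Y : Matrix (Fin p) (Fin q) ℝ) :
    frobNorm (X - Y) ≤ frobNorm X + frobNorm Y := by
  simpa only [frobNorm_eq_norm] using norm_sub_le X Y

lemma frobNorm_mul_le {p q r : ℕ} (X : Matrix (Fin p) (Fin q) ℝ) (Y : Matrix (Fin q) (Fin r) ℝ) :
    frobNorm (X * Y) ≤ frobNorm X * frobNorm Y := by
  simpa only [frobNorm_eq_norm] using frobenius_norm_mul X Y

end

lemma Matrix.IsHermitian.exists_diagonalization {m : ℕ} {M : Matrix (Fin m) (Fin m) ℝ}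
    (hM : M.IsHermitian) : ∃ U : Matrix (Fin m) (Fin m) ℝ, U * Uᵀ = 1 ∧ Uᵀ * U = 1 ∧
      M = U * diagonal hM.eigenvalues * Uᵀ := by
  refine ⟨hM.eigenvectorUnitary, ?_, ?_, ?_⟩
  · simpa [star_eq_conjTranspose] using Unitary.coe_mul_star_self hM.eigenvectorUnitary
  · simpa [star_eq_conjTranspose] using Unitary.coe_star_mul_self hM.eigenvectorUnitary
  · simpa [Unitary.conjStarAlgAut_apply, star_eq_conjTranspose, Function.comp_def]
      using hM.spectral_theorem

lemma trace_transpose_diagonal_mul {m q : ℕ} (d : Fin m → ℝ) (Y : Matrix (Fin m) (Fin q) ℝ) :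
    trace (Yᵀ * (diagonal d * Y)) = ∑ i, ∑ j, d i * (Y i j) ^ 2 := by
  rw [trace_transpose_mul_eq_sum]
  simp only [diagonal_mul]
  exact Finset.sum_congr rfl fun i _ => Finset.sum_congr rfl fun j _ => by ring

lemma eigMin_mul_frobNorm_sq_le {m q : ℕ} {M : Matrix (Fin m) (Fin m) ℝ} (hM : M.IsHermitian)
    (X : Matrix (Fin m) (Fin q) ℝ) : eigMin M * frobNorm X ^ 2 ≤ trace (Xᵀ * M * X) := by
  obtain ⟨U, hU, -, hMU⟩ := hM.exists_diagonalization
  have h1 : trace (Xᵀ * M * X) = ∑ i, ∑ j, hM.eigenvalues i * ((Uᵀ * X) i j) ^ 2 := by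
    rw [← trace_transpose_diagonal_mul]
    conv_lhs => rw [hMU]
    simp only [transpose_mul, transpose_transpose, Matrix.mul_assoc]
  have h2 : frobNorm X ^ 2 = ∑ i, ∑ j, ((Uᵀ * X) i j) ^ 2 := by
    have h3 : Xᵀ * X = (Uᵀ * X)ᵀ * (Uᵀ * X) := by
      rw [transpose_mul, transpose_transpose, Matrix.mul_assoc, ← Matrix.mul_assoc U, hU,
        Matrix.one_mul]
    rw [frobNorm_sq, h3, trace_transpose_mul_eq_sum]
    simp only [pow_two]
  rw [h1, h2, Finset.mul_sum]
  refine Finset.sum_le_sum fun i _ => ?_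
  rw [Finset.mul_sum]
  refine Finset.sum_le_sum fun j _ => mul_le_mul_of_nonneg_right ?_ (sq_nonneg _)
  rw [eigMin, dif_pos hM]
  exact ciInf_le (Set.finite_range _).bddBelow i

lemma frobNorm_mul_le_eigMax {m q : ℕ} {M : Matrix (Fin m) (Fin m) ℝ} (hM : M.PosDef)
    (X : Matrix (Fin m) (Fin q) ℝ) : frobNorm (M * X) ≤ eigMax M * frobNorm X := by
  have hmax : ∀ i, hM.1.eigenvalues i ≤ eigMax M := fun i => by
    rw [eigMax, dif_pos hM.1]
    exact le_ciSup (Set.finite_range _).bddAbove i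
  have hmax0 : 0 ≤ eigMax M := by
    rw [eigMax, dif_pos hM.1]
    exact Real.iSup_nonneg fun i => (hM.eigenvalues_pos i).le
  obtain ⟨U, hU, hU', hMU⟩ := hM.1.exists_diagonalization
  refine abs_le_of_sq_le_sq' ?_ (mul_nonneg hmax0 (frobNorm_nonneg X)) |>.2
  have h1 : frobNorm (M * X) ^ 2 = ∑ i, ∑ j, (hM.1.eigenvalues i * (Uᵀ * X) i j) ^ 2 := by
    have h3 : (M * X)ᵀ * (M * X) = (diagonal hM.1.eigenvalues * (Uᵀ * X))ᵀ *
        (diagonal hM.1.eigenvalues * (Uᵀ * X)) := by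
      conv_lhs => rw [hMU]
      simp only [transpose_mul, transpose_transpose, Matrix.mul_assoc]
      rw [← Matrix.mul_assoc Uᵀ U, hU', Matrix.one_mul]
    rw [frobNorm_sq, h3, trace_transpose_mul_eq_sum]
    simp only [diagonal_mul, pow_two]
  have h2 : frobNorm X ^ 2 = ∑ i, ∑ j, ((Uᵀ * X) i j) ^ 2 := by
    have h3 : Xᵀ * X = (Uᵀ * X)ᵀ * (Uᵀ * X) := by
      rw [transpose_mul, transpose_transpose, Matrix.mul_assoc, ← Matrix.mul_assoc U, hU,
        Matrix.one_mul]
    rw [frobNorm_sq, h3, trace_transpose_mul_eq_sum]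
    simp only [pow_two]
  rw [mul_pow, h1, h2, Finset.mul_sum]
  refine Finset.sum_le_sum fun i _ => ?_
  rw [Finset.mul_sum]
  refine Finset.sum_le_sum fun j _ => ?_
  rw [mul_pow]
  exact mul_le_mul_of_nonneg_right
    (pow_le_pow_left₀ (hM.eigenvalues_pos i).le (hmax i) 2) (sq_nonneg _)

lemma eigMin_pos {m : ℕ} (hm : 0 < m) {M : Matrix (Fin m) (Fin m) ℝ} (hM : M.PosDef) :
    0 < eigMin M := by
  have : Nonempty (Fin m) := ⟨⟨0, hm⟩⟩
  rw [eigMin, dif_pos hM.1]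
  obtain ⟨i, hi⟩ := exists_eq_ciInf_of_finite (f := hM.1.eigenvalues)
  rw [← hi]
  exact hM.eigenvalues_pos i

/-- Two solutions of a Riccati equation coincide when the associated closed-loop matrices are
Hurwitz. -/
lemma riccati_solution_unique {N : ℕ} {E G Q P₁ P₂ : Matrix (Fin N) (Fin N) ℝ} (hG : Gᵀ = G)
    (h₁ : Eᵀ * P₁ + P₁ * E + Q + P₁ * G * P₁ = 0) (h₂ : Eᵀ * P₂ + P₂ * E + Q + P₂ * G * P₂ = 0)
    (hH₁ : IsHurwitz (E + G * P₁ᵀ)) (hH₂ : IsHurwitz (E + G * P₂)) : P₁ = P₂ := by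
  rw [← sub_eq_zero]
  apply hH₁.sylvester_eq_zero hH₂
  rw [transpose_add, transpose_mul, transpose_transpose, hG]
  calc (Eᵀ + P₁ * G) * (P₁ - P₂) + (P₁ - P₂) * (E + G * P₂)
      = (Eᵀ * P₁ + P₁ * E + Q + P₁ * G * P₁) - (Eᵀ * P₂ + P₂ * E + Q + P₂ * G * P₂) := by
        noncomm_ring
    _ = 0 := by rw [h₁, h₂, sub_zero]

section
attribute [local instance] Matrix.frobeniusNormedRing Matrix.frobeniusNormedAlgebra

/-- Near a solution with Hurwitz closed loop, the Riccati equation has a differentiable branch of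
solutions along every affine perturbation of the drift matrix. -/
lemma exists_riccati_branch {N : ℕ} {E G Q P : Matrix (Fin N) (Fin N) ℝ}
    (H : Matrix (Fin N) (Fin N) ℝ) (hG : Gᵀ = G) (hP : Pᵀ = P)
    (h : Eᵀ * P + P * E + Q + P * G * P = 0) (hH : IsHurwitz (E + G * P)) :
    ∃ (φ : ℝ → Matrix (Fin N) (Fin N) ℝ) (X : Matrix (Fin N) (Fin N) ℝ), φ 0 = P ∧
      (∀ i j, HasDerivAt (fun t => φ t i j) (X i j) 0) ∧
      (E + G * P)ᵀ * X + X * (E + G * P) + Hᵀ * P + P * H = 0 ∧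
      ∀ᶠ t in 𝓝 (0 : ℝ), (E + t • H)ᵀ * φ t + φ t * (E + t • H) + Q + φ t * G * φ t = 0 := by
  have hT : (E + G * P)ᵀ = Eᵀ + P * G := by rw [transpose_add, transpose_mul, hG, hP]
  obtain ⟨φ, X, h0, hd, hX, hev⟩ := exists_hasDerivAt_quadratic_solution Eᵀ Hᵀ E H Q G P h
    fun x hx => hH.sylvester_eq_zero hH (by rw [hT]; exact hx)
  refine ⟨φ, X, h0, fun i j => ?_, ?_, ?_⟩
  · exact (entryLinearMap ℝ ℝ i j).toContinuousLinearMap.hasFDerivAt.comp_hasDerivAt (0 : ℝ) hd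
  · rw [hT]; exact hX
  · filter_upwards [hev] with t ht
    rw [transpose_add, transpose_smul]
    exact ht

end

lemma hasDerivAt_trace_transpose_mul {p q : ℕ} {U V : ℝ → Matrix (Fin p) (Fin q) ℝ}
    {U' V' : Matrix (Fin p) (Fin q) ℝ} {s : ℝ} (hU : ∀ i j, HasDerivAt (fun t => U t i j) (U' i j) s)
    (hV : ∀ i j, HasDerivAt (fun t => V t i j) (V' i j) s) :
    HasDerivAt (fun t => trace ((U t)ᵀ * V t)) (trace (U'ᵀ * V s) + trace ((U s)ᵀ * V')) s := by
  simp only [trace_transpose_mul_eq_sum, ← Finset.sum_add_distrib]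
  exact HasDerivAt.fun_sum fun i _ => HasDerivAt.fun_sum fun j _ => (hU i j).mul (hV i j)

lemma hasDerivAt_const_mul_entry {p q r : ℕ} (C : Matrix (Fin p) (Fin q) ℝ)
    {V : ℝ → Matrix (Fin q) (Fin r) ℝ} {V' : Matrix (Fin q) (Fin r) ℝ} {s : ℝ}
    (hV : ∀ i j, HasDerivAt (fun t => V t i j) (V' i j) s) (i : Fin p) (j : Fin r) :
    HasDerivAt (fun t => (C * V t) i j) ((C * V') i j) s := by
  simp only [mul_apply]
  exact HasDerivAt.fun_sum fun k _ => (hV k j).const_mul _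

/-- A solution of a Riccati equation is bounded in terms of a Lyapunov certificate of its closed
loop. -/
lemma abs_riccati_solution_le {N : ℕ} {E G Q P S : Matrix (Fin N) (Fin N) ℝ} {δ : ℝ} (hδ : 0 < δ)
    (hG : G.PosSemidef) (hP : P.PosDef) (hS : S.PosDef)
    (h : Eᵀ * P + P * E + Q + P * G * P = 0)
    (hcert : ∀ x, x ⬝ᵥ ((E + G * P)ᵀ * S + S * (E + G * P)) *ᵥ x ≤ -(2 * δ) * (x ⬝ᵥ x))
    (i j : Fin N) : |P i j| ≤ frobNorm Q / (2 * δ) * frobNorm S := by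
  obtain ⟨c, v, hv0, hv, hle⟩ := hS.exists_generalized_eigenvector i.pos hP.1
  have hPT : Pᵀ = P := by simpa using hP.1.eq
  have hGT : Gᵀ = G := by simpa using hG.1.eq
  have hvv : 0 < v ⬝ᵥ v := by simpa using dotProduct_star_self_pos_iff.mpr hv0
  have hc0 : 0 < c := by
    have h1 : 0 < v ⬝ᵥ P *ᵥ v := by simpa using hP.dotProduct_mulVec_pos hv0
    have h2 : 0 < v ⬝ᵥ S *ᵥ v := by simpa using hS.dotProduct_mulVec_pos hv0
    rw [hv, dotProduct_smul, smul_eq_mul] at h1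
    exact pos_of_mul_pos_left h1 h2.le
  have hc : c ≤ frobNorm Q / (2 * δ) := by
    have h1 : v ⬝ᵥ ((E + G * P)ᵀ * P + P * (E + G * P)) *ᵥ v =
        c * (v ⬝ᵥ ((E + G * P)ᵀ * S + S * (E + G * P)) *ᵥ v) := by
      rw [dotProduct_lyapunov_mulVec hP.1, dotProduct_lyapunov_mulVec hS.1,
        dotProduct_mulVec_comm_of_isHermitian hP.1, hv, dotProduct_smul,
        dotProduct_mulVec_comm_of_isHermitian hS.1, smul_eq_mul]
      ring
    have h2 : (E + G * P)ᵀ * P + P * (E + G * P) = Pᵀ * G * P - Q := by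
      rw [transpose_add, transpose_mul, hGT, hPT, eq_sub_iff_add_eq, ← sub_eq_zero]
      rw [← h]
      noncomm_ring
    have h3 : 0 ≤ v ⬝ᵥ (Pᵀ * G * P) *ᵥ v := by
      have := (hG.conjTranspose_mul_mul_same P).dotProduct_mulVec_nonneg v
      simpa using this
    have h4 := dotProduct_mulVec_le_frobNorm Q v
    have h5 := mul_le_mul_of_nonneg_left (hcert v) hc0.le
    rw [← h1, h2, sub_mulVec, dotProduct_sub] at h5
    rw [le_div_iff₀ (by positivity)]
    have h6 : c * (2 * δ) * (v ⬝ᵥ v) ≤ frobNorm Q * (v ⬝ᵥ v) := by linarith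
    exact le_of_mul_le_mul_right h6 hvv
  have hdiag : ∀ k, P k k ≤ frobNorm Q / (2 * δ) * frobNorm S := by
    intro k
    have h1 := hle (Pi.single k 1)
    have h2 := dotProduct_mulVec_le_frobNorm S (Pi.single k 1)
    simp at h1 h2
    have h3 : 0 ≤ S k k := hS.posSemidef.diag_nonneg
    calc P k k ≤ c * S k k := h1
      _ ≤ frobNorm Q / (2 * δ) * frobNorm S :=
        mul_le_mul hc h2 h3 (hc0.le.trans hc)
  have hij : P j i = P i j := congrFun (congrFun hPT i) j
  have h1 := hP.posSemidef.dotProduct_mulVec_nonneg (Pi.single i 1 + Pi.single j 1)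
  have h2 := hP.posSemidef.dotProduct_mulVec_nonneg (Pi.single i 1 - Pi.single j 1)
  simp [mulVec_add, mulVec_sub, add_dotProduct, sub_dotProduct] at h1 h2
  rw [abs_le]
  constructor <;> linarith [hdiag i, hdiag j]

/-- Closed loops whose cost does not exceed the nominal one share a Lyapunov certificate. -/
lemma closedLoop_certificate {A S : Matrix (Fin n) (Fin n) ℝ} {Bu : Matrix (Fin n) (Fin m_u) ℝ}
    {Ba : Matrix (Fin n) (Fin m_a) ℝ} {Γ : Matrix (Fin m_u) (Fin m_u) ℝ}
    {K₀ Kbar K : Matrix (Fin m_a) (Fin n) ℝ} {Λ : Matrix (Fin m_u) (Fin n) ℝ} {ε : ℝ}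
    (hS : S.PosDef) (hε0 : 0 < ε) (hΓ : Γ.PosDef) (hmin : 0 < eigMin Γ)
    (hSeq : (A + Ba * K₀)ᵀ * S + S * (A + Ba * K₀) + (2 : ℝ) • (1 : Matrix (Fin n) (Fin n) ℝ) = 0)
    (hdist : frobNorm (K₀ - Kbar) ≤ (ε / 2) * (Real.sqrt (eigMin Γ) /
        (Real.sqrt (eigMin Γ) * frobNorm (S * Ba) + frobNorm (S * Bu))))
    (hcost : frobNorm (K - Kbar) ^ 2 + trace (Λᵀ * Γ * Λ) ≤ frobNorm (K₀ - Kbar) ^ 2)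
    (x : Fin n → ℝ) :
    x ⬝ᵥ ((A + Bu * Λ + Ba * K)ᵀ * S + S * (A + Bu * Λ + Ba * K)) *ᵥ x ≤
      -(2 * (1 - ε)) * (x ⬝ᵥ x) := by
  set σ := Real.sqrt (eigMin Γ) with hσ
  have hσ0 : 0 < σ := Real.sqrt_pos.mpr hmin
  set δ := frobNorm (K₀ - Kbar) with hδ
  have hδ0 : 0 ≤ δ := frobNorm_nonneg _
  have hΛΓ := eigMin_mul_frobNorm_sq_le hΓ.1 Λ
  have hK : frobNorm (K - Kbar) ≤ δ := by
    refine (abs_le_of_sq_le_sq' ?_ hδ0).2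
    nlinarith [mul_nonneg hmin.le (sq_nonneg (frobNorm Λ))]
  have hΛ : σ * frobNorm Λ ≤ δ := by
    refine (abs_le_of_sq_le_sq' ?_ hδ0).2
    rw [mul_pow, hσ, Real.sq_sqrt hmin.le]
    nlinarith [sq_nonneg (frobNorm (K - Kbar))]
  have hKK : frobNorm (K - K₀) ≤ 2 * δ := by
    have h1 : K - K₀ = (K - Kbar) - (K₀ - Kbar) := by abel
    rw [h1]
    linarith [frobNorm_sub_le (K - Kbar) (K₀ - Kbar)]
  set a := frobNorm (S * Ba) with ha
  set b := frobNorm (S * Bu) with hb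
  have ha0 : 0 ≤ a := frobNorm_nonneg _
  have hb0 : 0 ≤ b := frobNorm_nonneg _
  have hD : 0 ≤ σ * a + b := by positivity
  have hδε : 2 * δ * (σ * a + b) ≤ ε * σ := by
    rcases hD.eq_or_lt with h | h
    · rw [← h]; simp only [mul_zero]; positivity
    · have h1 := mul_le_mul_of_nonneg_right hdist h.le
      have h2 : ε / 2 * (σ / (σ * a + b)) * (σ * a + b) = ε / 2 * σ := by
        field_simp
      rw [h2] at h1
      linarith
  set W := Ba * (K - K₀) + Bu * Λ with hW
  have hSW : frobNorm (S * W) ≤ ε := by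
    have h1 : S * W = S * Ba * (K - K₀) + S * Bu * Λ := by
      rw [hW, Matrix.mul_add, Matrix.mul_assoc, Matrix.mul_assoc]
    have h2 : frobNorm (S * W) ≤ a * frobNorm (K - K₀) + b * frobNorm Λ := by
      rw [h1]
      exact (frobNorm_add_le _ _).trans (add_le_add (frobNorm_mul_le _ _) (frobNorm_mul_le _ _))
    have h3 : σ * frobNorm (S * W) ≤ σ * ε := by
      have h4 := mul_le_mul_of_nonneg_left h2 hσ0.le
      have h5 := mul_le_mul_of_nonneg_left hKK (mul_nonneg hσ0.le ha0)
      have h6 := mul_le_mul_of_nonneg_left hΛ hb0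
      nlinarith [mul_nonneg hδ0 hb0]
    exact le_of_mul_le_mul_left h3 hσ0
  have hM : A + Bu * Λ + Ba * K = (A + Ba * K₀) + W := by
    rw [hW, Matrix.mul_sub]; abel
  have hsplit : (A + Bu * Λ + Ba * K)ᵀ * S + S * (A + Bu * Λ + Ba * K) =
      (Wᵀ * S + S * W) - (2 : ℝ) • (1 : Matrix (Fin n) (Fin n) ℝ) := by
    rw [eq_sub_iff_add_eq, hM, transpose_add, Matrix.add_mul, Matrix.mul_add]
    rw [← add_zero (Wᵀ * S + S * W), ← hSeq]
    abel
  rw [hsplit, sub_mulVec, dotProduct_sub, dotProduct_lyapunov_mulVec hS.1, mulVec_mulVec,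
    smul_mulVec, one_mulVec, dotProduct_smul, smul_eq_mul]
  have h1 := dotProduct_mulVec_le_frobNorm (S * W) x
  have h2 : 0 ≤ x ⬝ᵥ x := by simpa using dotProduct_star_self_nonneg x
  nlinarith [mul_le_mul_of_nonneg_right hSW h2]

lemma certificate_posDef {N : ℕ} {M S : Matrix (Fin N) (Fin N) ℝ} {δ : ℝ} (hδ : 0 < δ)
    (hS : S.IsHermitian) (h : ∀ x, x ⬝ᵥ (Mᵀ * S + S * M) *ᵥ x ≤ -(2 * δ) * (x ⬝ᵥ x)) :
    (-(Mᵀ * S + S * M)).PosDef := by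
  refine .of_dotProduct_mulVec_pos (isHermitian_lyapunov hS M) fun {x} hx => ?_
  have h1 : 0 < x ⬝ᵥ x := by simpa using dotProduct_star_self_pos_iff.mpr hx
  rw [star_trivial, neg_mulVec, dotProduct_neg]
  nlinarith [h x, mul_pos hδ h1]

lemma isStabSol_iff {A P Q : Matrix (Fin n) (Fin n) ℝ} {Bu : Matrix (Fin n) (Fin m_u) ℝ}
    {Ba : Matrix (Fin n) (Fin m_a) ℝ} {R : Matrix (Fin m_a) (Fin m_a) ℝ}
    {Λ : Matrix (Fin m_u) (Fin n) ℝ} :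
    IsStabSol A Bu Ba Q R Λ P ↔ P.PosDef ∧
      (A + Bu * Λ)ᵀ * P + P * (A + Bu * Λ) + Q + P * (Ba * R⁻¹ * Baᵀ) * P = 0 ∧
      IsHurwitz (A + Bu * Λ + (Ba * R⁻¹ * Baᵀ) * P) := by
  simp only [IsStabSol, Matrix.mul_assoc]

lemma posSemidef_gain {Ba : Matrix (Fin n) (Fin m_a) ℝ} {R : Matrix (Fin m_a) (Fin m_a) ℝ}
    (hR : R.PosDef) : (Ba * R⁻¹ * Baᵀ).PosSemidef := by
  simpa using hR.inv.posSemidef.mul_mul_conjTranspose_same Ba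

lemma transpose_gain {Ba : Matrix (Fin n) (Fin m_a) ℝ} {R : Matrix (Fin m_a) (Fin m_a) ℝ}
    (hR : R.PosDef) : (Ba * R⁻¹ * Baᵀ)ᵀ = Ba * R⁻¹ * Baᵀ := by
  simpa using (posSemidef_gain (Ba := Ba) hR).1.eq

lemma IsStabSol.unique {A P₁ P₂ Q : Matrix (Fin n) (Fin n) ℝ} {Bu : Matrix (Fin n) (Fin m_u) ℝ}
    {Ba : Matrix (Fin n) (Fin m_a) ℝ} {R : Matrix (Fin m_a) (Fin m_a) ℝ} (hR : R.PosDef)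
    {Λ : Matrix (Fin m_u) (Fin n) ℝ} (h₁ : IsStabSol A Bu Ba Q R Λ P₁)
    (h₂ : IsStabSol A Bu Ba Q R Λ P₂) : P₁ = P₂ := by
  rw [isStabSol_iff] at h₁ h₂
  have hT : P₁ᵀ = P₁ := by simpa using h₁.1.1.eq
  exact riccati_solution_unique (transpose_gain hR) h₁.2.1 h₂.2.1 (by rw [hT]; exact h₁.2.2) h₂.2.2

lemma IsLyapSol.unique {A P Q W₁ W₂ : Matrix (Fin n) (Fin n) ℝ} {Bu : Matrix (Fin n) (Fin m_u) ℝ}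
    {Ba : Matrix (Fin n) (Fin m_a) ℝ} {R : Matrix (Fin m_a) (Fin m_a) ℝ}
    {Kbar : Matrix (Fin m_a) (Fin n) ℝ} {Λ : Matrix (Fin m_u) (Fin n) ℝ}
    (hP : IsStabSol A Bu Ba Q R Λ P) (h₁ : IsLyapSol A Bu Ba R Kbar Λ P W₁)
    (h₂ : IsLyapSol A Bu Ba R Kbar Λ P W₂) : W₁ = W₂ := by
  set M := A + Bu * Λ + Ba * R⁻¹ * Baᵀ * P with hM
  have hMT : IsHurwitz Mᵀ := by
    intro μ hμ
    refine hP.2.2 μ ?_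
    rw [Matrix.mem_spectrum_iff_isRoot_charpoly] at hμ ⊢
    rwa [transpose_map, Matrix.charpoly_transpose] at hμ
  rw [← sub_eq_zero]
  refine hMT.sylvester_eq_zero hMT ?_
  rw [transpose_transpose, Matrix.mul_sub, Matrix.sub_mul]
  have h3 := h₁.2.trans h₂.2.symm
  rw [← hM, ← sub_eq_zero] at h3
  rw [← h3]
  abel

/-- The adjoint identity expressing the derivative of the gain mismatch through `Π`. -/
lemma trace_adjoint_identity {N k : ℕ} {M Z P X H : Matrix (Fin N) (Fin N) ℝ}
    {C V : Matrix (Fin k) (Fin N) ℝ} (hZ : Zᵀ = Z) (hP : Pᵀ = P) (hX : Xᵀ = X)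
    (hLyap : M * Z + Z * Mᵀ + Cᵀ * V + Vᵀ * C = 0)
    (hlin : Mᵀ * X + X * M + Hᵀ * P + P * H = 0) :
    trace (Vᵀ * (C * X)) = trace (Z * P * H) := by
  have h1 : trace (Cᵀ * V * X) = trace (Vᵀ * C * X) := by
    rw [← trace_transpose, transpose_mul, transpose_mul, transpose_transpose, hX, trace_mul_comm]
  have h2 : trace (Z * Hᵀ * P) = trace (Z * P * H) := by
    rw [← trace_transpose, transpose_mul, transpose_mul, transpose_transpose, hP, hZ,
      ← Matrix.mul_assoc, trace_mul_cycle P H Z]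
  have h3 : trace (M * Z * X) = trace (Z * X * M) := by
    rw [Matrix.mul_assoc, trace_mul_comm]
  have h4 := congrArg (fun Y => trace (Y * X)) hLyap
  have h5 := congrArg (fun Y => trace (Z * Y)) hlin
  simp only [Matrix.add_mul, Matrix.mul_add, ← Matrix.mul_assoc, trace_add, Matrix.zero_mul,
    Matrix.mul_zero, trace_zero] at h4 h5
  rw [← Matrix.mul_assoc]
  linarith

lemma Jcost_zero {Ba : Matrix (Fin n) (Fin m_a) ℝ} {R : Matrix (Fin m_a) (Fin m_a) ℝ}
    {Γ : Matrix (Fin m_u) (Fin m_u) ℝ} {Kbar : Matrix (Fin m_a) (Fin n) ℝ}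
    {Pu : Matrix (Fin m_u) (Fin n) ℝ → Matrix (Fin n) (Fin n) ℝ} :
    Jcost Ba R Γ Kbar Pu 0 = frobNorm (R⁻¹ * Baᵀ * Pu 0 - Kbar) ^ 2 := by
  simp [Jcost]

/-- The sublevel set `S₀` is closed. -/
lemma isClosed_S0 {A Q S : Matrix (Fin n) (Fin n) ℝ} {Bu : Matrix (Fin n) (Fin m_u) ℝ}
    {Ba : Matrix (Fin n) (Fin m_a) ℝ} {R : Matrix (Fin m_a) (Fin m_a) ℝ}
    {Γ : Matrix (Fin m_u) (Fin m_u) ℝ} {Kbar : Matrix (Fin m_a) (Fin n) ℝ}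
    {Pu : Matrix (Fin m_u) (Fin n) ℝ → Matrix (Fin n) (Fin n) ℝ} {δ : ℝ}
    (hQ : Q.PosDef) (hR : R.PosDef) (hS : S.PosDef) (hδ : 0 < δ)
    (hPu : ∀ Λ, (∃ P, IsStabSol A Bu Ba Q R Λ P) → IsStabSol A Bu Ba Q R Λ (Pu Λ))
    (hcert : ∀ (K : Matrix (Fin m_a) (Fin n) ℝ) (Λ : Matrix (Fin m_u) (Fin n) ℝ),
      frobNorm (K - Kbar) ^ 2 + trace (Λᵀ * Γ * Λ) ≤ Jcost Ba R Γ Kbar Pu 0 →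
      ∀ x, x ⬝ᵥ ((A + Bu * Λ + Ba * K)ᵀ * S + S * (A + Bu * Λ + Ba * K)) *ᵥ x ≤
        -(2 * δ) * (x ⬝ᵥ x)) :
    IsClosed (S0 A Bu Ba Q R Γ Kbar Pu) := by
  have : SequentialSpace (Matrix (Fin m_u) (Fin n) ℝ) :=
    inferInstanceAs (SequentialSpace (Fin m_u → Fin n → ℝ))
  refine IsSeqClosed.isClosed fun Λs Λ hmem hlim => ?_
  have hG := posSemidef_gain (Ba := Ba) hR
  have hst k := isStabSol_iff.mp (hPu _ (hmem k).1)
  have hbd : ∀ k i j, |Pu (Λs k) i j| ≤ frobNorm Q / (2 * δ) * frobNorm S := fun k =>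
    abs_riccati_solution_le hδ hG (hst k).1 hS (hst k).2.1 fun x => by
      have := hcert _ _ (hmem k).2 x
      simpa only [Matrix.mul_assoc] using this
  set c := frobNorm Q / (2 * δ) * frobNorm S
  have hcomp : IsCompact (Set.univ.pi fun _ : Fin n => Set.univ.pi fun _ : Fin n => Set.Icc (-c) c) :=
    isCompact_univ_pi fun _ => isCompact_univ_pi fun _ => isCompact_Icc
  obtain ⟨P, ψ, hψ, hP⟩ : ∃ (P : Matrix (Fin n) (Fin n) ℝ) (ψ : ℕ → ℕ), StrictMono ψ ∧
      Tendsto (fun k => Pu (Λs (ψ k))) atTop (𝓝 P) := by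
    obtain ⟨P, -, ψ, hψ, hP⟩ := hcomp.tendsto_subseq (X := Fin n → Fin n → ℝ)
      (x := fun k => Pu (Λs k)) fun k i _ j _ => abs_le.mp (hbd k i j)
    exact ⟨P, ψ, hψ, hP⟩
  have hz : Tendsto (fun k => (Λs (ψ k), Pu (Λs (ψ k)))) atTop (𝓝 (Λ, P)) :=
    (hlim.comp hψ.tendsto_atTop).prodMk_nhds hP
  have hsym : Pᵀ = P := by
    have hc : Continuous fun P : Matrix (Fin n) (Fin n) ℝ => Pᵀ := by fun_prop
    refine tendsto_nhds_unique ((hc.tendsto P).comp hP) (hP.congr fun k => ?_)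
    simpa using (hst (ψ k)).1.1.eq.symm
  have hpsd : ∀ x, 0 ≤ x ⬝ᵥ P *ᵥ x := fun x => by
    have hc : Continuous fun P : Matrix (Fin n) (Fin n) ℝ => x ⬝ᵥ P *ᵥ x := by fun_prop
    refine ge_of_tendsto' ((hc.tendsto P).comp hP) fun k => ?_
    simpa using (hst (ψ k)).1.posSemidef.dotProduct_mulVec_nonneg x
  have hare : (A + Bu * Λ)ᵀ * P + P * (A + Bu * Λ) + Q + P * (Ba * R⁻¹ * Baᵀ) * P = 0 := by
    have hc : Continuous fun z : Matrix (Fin m_u) (Fin n) ℝ × Matrix (Fin n) (Fin n) ℝ =>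
        (A + Bu * z.1)ᵀ * z.2 + z.2 * (A + Bu * z.1) + Q + z.2 * (Ba * R⁻¹ * Baᵀ) * z.2 := by
      fun_prop
    refine tendsto_nhds_unique ((hc.tendsto (Λ, P)).comp hz) (tendsto_const_nhds.congr fun k => ?_)
    exact (hst (ψ k)).2.1.symm
  have hcost : frobNorm (R⁻¹ * Baᵀ * P - Kbar) ^ 2 + trace (Λᵀ * Γ * Λ) ≤
      Jcost Ba R Γ Kbar Pu 0 := by
    have hc : Continuous fun z : Matrix (Fin m_u) (Fin n) ℝ × Matrix (Fin n) (Fin n) ℝ =>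
        frobNorm (R⁻¹ * Baᵀ * z.2 - Kbar) ^ 2 + trace (z.1ᵀ * Γ * z.1) := by
      simp only [frobNorm_sq]
      fun_prop
    exact le_of_tendsto' ((hc.tendsto (Λ, P)).comp hz) fun k => (hmem (ψ k)).2
  have hpos : P.PosDef := by
    have hPS : P.PosSemidef := .of_dotProduct_mulVec_nonneg (by simpa [IsHermitian] using hsym)
      fun x => by simpa using hpsd x
    refine .of_dotProduct_mulVec_pos hPS.1 fun {x} hx => ?_
    refine (hPS.dotProduct_mulVec_nonneg x).lt_of_ne fun h0 => ?_
    have hPx : P *ᵥ x = 0 := (hPS.dotProduct_mulVec_zero_iff x).mp h0.symm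
    have hQx : x ⬝ᵥ Q *ᵥ x = 0 := by
      have h1 := congrArg (fun M => x ⬝ᵥ M *ᵥ x) hare
      simpa only [add_mulVec, ← mulVec_mulVec, hPx, dotProduct_add, mulVec_zero, dotProduct_zero,
        dotProduct_mulVec x P, ← mulVec_transpose, hsym, zero_dotProduct, zero_mulVec, zero_add,
        add_zero] using h1
    have := hQ.dotProduct_mulVec_pos hx
    rw [star_trivial, hQx] at this
    exact this.false
  have hstab : IsStabSol A Bu Ba Q R Λ P := by
    refine isStabSol_iff.mpr ⟨hpos, hare, .of_lyapunov hS (certificate_posDef hδ hS.1 fun x => ?_)⟩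
    have := hcert _ _ hcost x
    simpa only [Matrix.mul_assoc] using this
  refine ⟨⟨P, hstab⟩, ?_⟩
  rwa [Jcost, (hPu Λ ⟨P, hstab⟩).unique hR hstab]

lemma HasDerivAt.eventually_lt_of_neg {f : ℝ → ℝ} {d : ℝ} (hf : HasDerivAt f d 0) (hd : d < 0) :
    ∀ᶠ t in 𝓝[>] (0 : ℝ), f t < f 0 := by
  filter_upwards [hf.tendsto_slope_zero_right.eventually_lt_const hd, self_mem_nhdsWithin] with t h ht
  have ht0 : 0 < t := ht
  rw [zero_add, smul_eq_mul] at h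
  by_contra! hle
  exact h.not_ge (mul_nonneg (inv_nonneg.mpr ht0.le) (sub_nonneg.mpr hle))

/-- A short step from a point of `S₀` along a descent direction of the cost stays in `S₀`. -/
lemma eventually_add_smul_mem_S0 {A Q S : Matrix (Fin n) (Fin n) ℝ}
    {Bu : Matrix (Fin n) (Fin m_u) ℝ}
    {Ba : Matrix (Fin n) (Fin m_a) ℝ} {R : Matrix (Fin m_a) (Fin m_a) ℝ}
    {Γ : Matrix (Fin m_u) (Fin m_u) ℝ} {Kbar : Matrix (Fin m_a) (Fin n) ℝ}
    {Pu Pim : Matrix (Fin m_u) (Fin n) ℝ → Matrix (Fin n) (Fin n) ℝ} {δ : ℝ}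
    (hQ : Q.PosDef) (hR : R.PosDef) (hΓ : Γ.PosDef) (hS : S.PosDef) (hδ : 0 < δ)
    (hPu : ∀ Λ, (∃ P, IsStabSol A Bu Ba Q R Λ P) → IsStabSol A Bu Ba Q R Λ (Pu Λ))
    (hPim : ∀ Λ, (∃ P, IsStabSol A Bu Ba Q R Λ P) →
      IsLyapSol A Bu Ba R Kbar Λ (Pu Λ) (Pim Λ))
    (hcert : ∀ (K : Matrix (Fin m_a) (Fin n) ℝ) (Λ : Matrix (Fin m_u) (Fin n) ℝ),
      frobNorm (K - Kbar) ^ 2 + trace (Λᵀ * Γ * Λ) ≤ Jcost Ba R Γ Kbar Pu 0 →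
      ∀ x, x ⬝ᵥ ((A + Bu * Λ + Ba * K)ᵀ * S + S * (A + Bu * Λ + Ba * K)) *ᵥ x ≤
        -(2 * δ) * (x ⬝ᵥ x))
    {Λ D : Matrix (Fin m_u) (Fin n) ℝ} (hΛ : Λ ∈ S0 A Bu Ba Q R Γ Kbar Pu)
    (hD : trace (((2 : ℝ) • (Γ * Λ + Buᵀ * Pu Λ * Pim Λ))ᵀ * D) < 0) :
    ∀ᶠ t in 𝓝[>] (0 : ℝ), Λ + t • D ∈ S0 A Bu Ba Q R Γ Kbar Pu := by
  have hst := isStabSol_iff.mp (hPu Λ hΛ.1)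
  have hlyap := hPim Λ hΛ.1
  have hcost := hΛ.2
  rw [Jcost] at hcost
  generalize Pu Λ = P at *
  generalize Pim Λ = Z at *
  have hQT : Qᵀ = Q := by simpa using hQ.1.eq
  have hΓT : Γᵀ = Γ := by simpa using hΓ.1.eq
  have hPT : Pᵀ = P := by simpa using hst.1.1.eq
  have hZT : Zᵀ = Z := by simpa using hlyap.1.eq
  have hRT : (R⁻¹)ᵀ = R⁻¹ := by simpa using hR.inv.1.eq
  have hGT := transpose_gain (Ba := Ba) hR
  have hcl := certificate_posDef hδ hS.1 (hcert _ _ hcost)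
  rw [← Matrix.mul_assoc, ← Matrix.mul_assoc] at hcl
  have hlyap' := hlyap.2
  set C := R⁻¹ * Baᵀ with hC
  set G := Ba * R⁻¹ * Baᵀ with hG
  obtain ⟨φ, X, hφ0, hd, hlin, hev⟩ :=
    exists_riccati_branch (Bu * D) hGT hPT hst.2.1 hst.2.2
  have hφ : Tendsto φ (𝓝 0) (𝓝 P) := by
    rw [← hφ0]
    exact tendsto_pi_nhds.mpr fun i => tendsto_pi_nhds.mpr fun j => (hd i j).continuousAt
  have hXT : Xᵀ = X := by
    rw [← sub_eq_zero]
    apply hst.2.2.sylvester_eq_zero hst.2.2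
    have h1 := congrArg transpose hlin
    simp only [transpose_add, transpose_mul, transpose_transpose, transpose_zero, hPT, hGT] at h1
    refine Eq.trans ?_ (sub_eq_zero.mpr (h1.trans hlin.symm))
    simp only [transpose_add, transpose_mul, hPT, hGT]
    noncomm_ring
  have hhur : ∀ᶠ t in 𝓝 (0 : ℝ), IsHurwitz (A + Bu * Λ + t • (Bu * D) + G * φ t) := by
    have hc : Continuous fun z : ℝ × Matrix (Fin n) (Fin n) ℝ =>
        -((A + Bu * Λ + z.1 • (Bu * D) + G * z.2)ᵀ * S +
          S * (A + Bu * Λ + z.1 • (Bu * D) + G * z.2)) := by fun_prop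
    have h1 := (hc.tendsto (0, P)).comp (tendsto_id.prodMk_nhds hφ)
    rw [zero_smul, add_zero] at h1
    filter_upwards [hcl.eventually h1 (.of_forall fun t => isHermitian_lyapunov hS.1 _)] with t ht
    exact .of_lyapunov hS ht
  have hsym : ∀ᶠ t in 𝓝 (0 : ℝ), (φ t)ᵀ = φ t := by
    filter_upwards [hev, hhur] with t h1 h2
    refine riccati_solution_unique hGT ?_ h1 (by rwa [transpose_transpose]) h2
    have h3 := congrArg transpose h1
    simp only [transpose_add, transpose_mul, transpose_transpose, transpose_zero, hQT, hGT] at h3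
    rw [← h3]
    simp only [transpose_add, transpose_mul, Matrix.mul_assoc]
    abel
  have hstab : ∀ᶠ t in 𝓝 (0 : ℝ), IsStabSol A Bu Ba Q R (Λ + t • D) (φ t) := by
    filter_upwards [hev, hhur, hst.1.eventually hφ (hsym.mono fun t ht => by
      simpa [IsHermitian] using ht)] with t h1 h2 h3
    have h4 : A + Bu * (Λ + t • D) = A + Bu * Λ + t • (Bu * D) := by
      rw [Matrix.mul_add, Matrix.mul_smul, add_assoc]
    rw [isStabSol_iff, h4]
    exact ⟨h3, h1, h2⟩
  have hderiv : HasDerivAt (fun t : ℝ => trace ((C * φ t - Kbar)ᵀ * (C * φ t - Kbar)) +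
      trace ((Λ + t • D)ᵀ * (Γ * (Λ + t • D))))
      (trace (((2 : ℝ) • (Γ * Λ + Buᵀ * P * Z))ᵀ * D)) 0 := by
    have h1 : ∀ i j, HasDerivAt (fun t => (C * φ t - Kbar) i j) ((C * X) i j) 0 := fun i j =>
      (hasDerivAt_const_mul_entry C hd i j).sub_const _
    have h2 : ∀ i j, HasDerivAt (fun t : ℝ => (Λ + t • D) i j) (D i j) 0 := fun i j => by
      simpa using ((hasDerivAt_id (0 : ℝ)).mul_const (D i j)).const_add (Λ i j)
    have h3 := (hasDerivAt_trace_transpose_mul h1 h1).add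
      (hasDerivAt_trace_transpose_mul h2 (hasDerivAt_const_mul_entry Γ h2))
    refine h3.congr_deriv ?_
    have h4 : trace ((C * P - Kbar)ᵀ * (C * X)) = trace (Z * P * (Bu * D)) := by
      refine trace_adjoint_identity hZT hPT hXT ?_ hlin
      rw [← hlyap']
      simp only [hC, hG, transpose_sub, transpose_mul, transpose_transpose, hRT, hPT,
        Matrix.mul_sub, Matrix.sub_mul, Matrix.mul_assoc]
      abel
    have h5 : trace ((C * X)ᵀ * (C * P - Kbar)) = trace ((C * P - Kbar)ᵀ * (C * X)) := by
      rw [← trace_transpose, transpose_mul, transpose_transpose]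
    have h6 : trace (Dᵀ * (Γ * Λ)) = trace (Λᵀ * (Γ * D)) := by
      rw [← trace_transpose, transpose_mul, transpose_mul, transpose_transpose, hΓT,
        Matrix.mul_assoc]
    rw [hφ0, zero_smul, add_zero, h5, h4, h6, transpose_smul, transpose_add, transpose_mul,
      transpose_mul, transpose_mul, hΓT, hPT, hZT, transpose_transpose, Matrix.smul_mul,
      Matrix.add_mul, trace_smul, trace_add, smul_eq_mul]
    simp only [Matrix.mul_assoc]
    ring
  filter_upwards [hderiv.eventually_lt_of_neg hD, nhdsWithin_le_nhds hstab] with t hlt hs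
  refine ⟨⟨_, hs⟩, le_trans ?_ hcost⟩
  rw [Jcost, (hPu _ ⟨_, hs⟩).unique hR hs, frobNorm_sq, frobNorm_sq, Matrix.mul_assoc (Λ + t • D)ᵀ,
    Matrix.mul_assoc Λᵀ, ← hC]
  simpa [hφ0] using hlt.le

/-- The step size condition makes the descent direction stay a descent direction along the step. -/
lemma trace_gradient_mul_step_neg {p q : ℕ} {Γ : Matrix (Fin p) (Fin p) ℝ} (hΓ : Γ.PosDef)
    {G₀ G₁ D : Matrix (Fin p) (Fin q) ℝ} {L ω t : ℝ} (hL : 0 < L) (ht : 0 ≤ t) (htω : t ≤ ω)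
    (hω : L * ω * eigMax Γ ^ 2 < 2 * eigMin Γ) (hG₀ : G₀ ≠ 0)
    (hD : D = -((1 / 2 : ℝ) • (Γ * G₀))) (hLip : frobNorm (G₁ - G₀) ≤ L * (t * frobNorm D)) :
    trace (G₁ᵀ * D) < 0 := by
  have hq : 0 < frobNorm G₀ := (frobNorm_nonneg _).lt_of_ne fun h => hG₀ (frobNorm_eq_zero h.symm)
  have hDn : frobNorm D ≤ 1 / 2 * (eigMax Γ * frobNorm G₀) := by
    rw [hD, frobNorm_neg, frobNorm_smul (by norm_num)]
    exact mul_le_mul_of_nonneg_left (frobNorm_mul_le_eigMax hΓ G₀) (by norm_num)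
  have hD2 : frobNorm D ^ 2 ≤ (1 / 2 * (eigMax Γ * frobNorm G₀)) ^ 2 :=
    pow_le_pow_left₀ (frobNorm_nonneg _) hDn 2
  have h0 : trace (G₀ᵀ * D) ≤ -(1 / 2) * (eigMin Γ * frobNorm G₀ ^ 2) := by
    have h1 := eigMin_mul_frobNorm_sq_le hΓ.1 G₀
    rw [hD, Matrix.mul_neg, trace_neg, Matrix.mul_smul, trace_smul, smul_eq_mul,
      ← Matrix.mul_assoc]
    linarith
  have h1 : trace ((G₁ - G₀)ᵀ * D) ≤ L * ω * frobNorm D ^ 2 := by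
    calc trace ((G₁ - G₀)ᵀ * D) ≤ frobNorm (G₁ - G₀) * frobNorm D := trace_transpose_mul_le _ _
      _ ≤ L * (t * frobNorm D) * frobNorm D := mul_le_mul_of_nonneg_right hLip (frobNorm_nonneg _)
      _ = L * t * frobNorm D ^ 2 := by ring
      _ ≤ L * ω * frobNorm D ^ 2 := by gcongr
  have h2 : trace (G₁ᵀ * D) = trace (G₀ᵀ * D) + trace ((G₁ - G₀)ᵀ * D) := by
    rw [transpose_sub, Matrix.sub_mul, trace_sub]
    ring
  have h3 := mul_le_mul_of_nonneg_left hD2 (mul_nonneg hL.le (ht.trans htω))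
  have h4 := mul_lt_mul_of_pos_right hω (pow_pos hq 2)
  rw [h2]
  nlinarith

/-- A step within the admissible size along the preconditioned negative gradient stays in `S₀`. -/
lemma step_mem_S0 {A Q S : Matrix (Fin n) (Fin n) ℝ} {Bu : Matrix (Fin n) (Fin m_u) ℝ}
    {Ba : Matrix (Fin n) (Fin m_a) ℝ} {R : Matrix (Fin m_a) (Fin m_a) ℝ}
    {Γ : Matrix (Fin m_u) (Fin m_u) ℝ} {Kbar : Matrix (Fin m_a) (Fin n) ℝ}
    {Pu Pim : Matrix (Fin m_u) (Fin n) ℝ → Matrix (Fin n) (Fin n) ℝ} {δ L ω : ℝ}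
    (hQ : Q.PosDef) (hR : R.PosDef) (hΓ : Γ.PosDef) (hS : S.PosDef) (hδ : 0 < δ)
    (hPu : ∀ Λ, (∃ P, IsStabSol A Bu Ba Q R Λ P) → IsStabSol A Bu Ba Q R Λ (Pu Λ))
    (hPim : ∀ Λ, (∃ P, IsStabSol A Bu Ba Q R Λ P) →
      IsLyapSol A Bu Ba R Kbar Λ (Pu Λ) (Pim Λ))
    (hcert : ∀ (K : Matrix (Fin m_a) (Fin n) ℝ) (Λ : Matrix (Fin m_u) (Fin n) ℝ),
      frobNorm (K - Kbar) ^ 2 + trace (Λᵀ * Γ * Λ) ≤ Jcost Ba R Γ Kbar Pu 0 →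
      ∀ x, x ⬝ᵥ ((A + Bu * Λ + Ba * K)ᵀ * S + S * (A + Bu * Λ + Ba * K)) *ᵥ x ≤
        -(2 * δ) * (x ⬝ᵥ x))
    (hL : 0 < L)
    (hLip : ∀ Λ₁ ∈ S0 A Bu Ba Q R Γ Kbar Pu, ∀ Λ₂ ∈ S0 A Bu Ba Q R Γ Kbar Pu,
      frobNorm ((2 : ℝ) • (Γ * Λ₁ + Buᵀ * Pu Λ₁ * Pim Λ₁) -
          (2 : ℝ) • (Γ * Λ₂ + Buᵀ * Pu Λ₂ * Pim Λ₂)) ≤ L * frobNorm (Λ₁ - Λ₂))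
    (hω0 : 0 < ω) (hω : L * ω * eigMax Γ⁻¹ ^ 2 < 2 * eigMin Γ⁻¹)
    {Λ G₀ D : Matrix (Fin m_u) (Fin n) ℝ} (hΛ : Λ ∈ S0 A Bu Ba Q R Γ Kbar Pu)
    (hG₀ : G₀ = (2 : ℝ) • (Γ * Λ + Buᵀ * Pu Λ * Pim Λ)) (hD : D = -((1 / 2 : ℝ) • (Γ⁻¹ * G₀))) :
    Λ + ω • D ∈ S0 A Bu Ba Q R Γ Kbar Pu := by
  rcases eq_or_ne G₀ 0 with h | h
  · rw [hD, h, Matrix.mul_zero, smul_zero, neg_zero, smul_zero, add_zero]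
    exact hΛ
  have hsub : Set.Icc 0 ω ⊆ {t : ℝ | Λ + t • D ∈ S0 A Bu Ba Q R Γ Kbar Pu} := by
    refine IsClosed.Icc_subset_of_forall_mem_nhdsWithin ?_ ?_ ?_
    · have hc : Continuous fun t : ℝ => Λ + t • D := by fun_prop
      exact ((isClosed_S0 hQ hR hS hδ hPu hcert).preimage hc).inter isClosed_Icc
    · change Λ + (0 : ℝ) • D ∈ S0 A Bu Ba Q R Γ Kbar Pu
      rwa [zero_smul, add_zero]
    · rintro t ⟨ht, ht0, htω⟩
      have hlip := hLip _ ht _ hΛ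
      rw [← hG₀, add_sub_cancel_left, frobNorm_smul ht0] at hlip
      have hneg := trace_gradient_mul_step_neg hΓ.inv hL ht0 htω.le hω h hD hlip
      have hev := eventually_add_smul_mem_S0 hQ hR hΓ hS hδ hPu hPim hcert ht hneg
      have hshift : Tendsto (fun s => s - t) (𝓝[>] t) (𝓝[>] 0) := by
        refine tendsto_nhdsWithin_iff.mpr ⟨?_, ?_⟩
        · have hc : Continuous fun s : ℝ => s - t := by fun_prop
          simpa using (hc.tendsto t).mono_left nhdsWithin_le_nhds
        · filter_upwards [self_mem_nhdsWithin] with s hs using sub_pos.mpr (Set.mem_Ioi.mp hs)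
      filter_upwards [hshift.eventually hev] with s hs
      rwa [add_assoc, ← add_smul, add_sub_cancel] at hs
  exact hsub ⟨hω0.le, le_rfl⟩

lemma pos_of_eigMin_ne_zero {m : ℕ} {M : Matrix (Fin m) (Fin m) ℝ} (h : eigMin M ≠ 0) : 0 < m := by
  refine Nat.pos_of_ne_zero fun hm => h ?_
  subst hm
  rw [eigMin]
  split_ifs
  · exact Real.iInf_of_isEmpty _
  · rfl

/-- Theorem 2, item 1: all iterates remain in `S₀`, so the
iteration is well defined at every step. -/
theorem stmt6
    (A : Matrix (Fin n) (Fin n) ℝ) (Bu : Matrix (Fin n) (Fin m_u) ℝ)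
    (Ba : Matrix (Fin n) (Fin m_a) ℝ)
    (Q : Matrix (Fin n) (Fin n) ℝ) (R : Matrix (Fin m_a) (Fin m_a) ℝ)
    (Γ : Matrix (Fin m_u) (Fin m_u) ℝ)
    (hQ : Q.PosDef) (hR : R.PosDef) (hΓ : Γ.PosDef)
    (Kbar : Matrix (Fin m_a) (Fin n) ℝ)
    (Pu Pim : Matrix (Fin m_u) (Fin n) ℝ → Matrix (Fin n) (Fin n) ℝ)
    (hPu : ∀ Λ, (∃ P, IsStabSol A Bu Ba Q R Λ P) → IsStabSol A Bu Ba Q R Λ (Pu Λ))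
    (hPim : ∀ Λ, (∃ P, IsStabSol A Bu Ba Q R Λ P) →
      IsLyapSol A Bu Ba R Kbar Λ (Pu Λ) (Pim Λ))
    (h0 : ∃ P, IsStabSol A Bu Ba Q R 0 P)
    (S : Matrix (Fin n) (Fin n) ℝ) (hS : S.PosDef)
    (hSeq : (A + Ba * (R⁻¹ * Baᵀ * Pu 0))ᵀ * S + S * (A + Ba * (R⁻¹ * Baᵀ * Pu 0))
      + (2 : ℝ) • (1 : Matrix (Fin n) (Fin n) ℝ) = 0)
    (ε : ℝ) (hε0 : 0 < ε) (hε1 : ε < 1)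
    (hdist : frobNorm (R⁻¹ * Baᵀ * Pu 0 - Kbar) ≤
      (ε / 2) * (Real.sqrt (eigMin Γ) /
        (Real.sqrt (eigMin Γ) * frobNorm (S * Ba) + frobNorm (S * Bu))))
    (L : ℝ) (hL : 0 < L)
    (hLip : ∀ Λ₁ ∈ S0 A Bu Ba Q R Γ Kbar Pu, ∀ Λ₂ ∈ S0 A Bu Ba Q R Γ Kbar Pu,
      frobNorm ((2 : ℝ) • (Γ * Λ₁ + Buᵀ * Pu Λ₁ * Pim Λ₁) -
          (2 : ℝ) • (Γ * Λ₂ + Buᵀ * Pu Λ₂ * Pim Λ₂)) ≤ L * frobNorm (Λ₁ - Λ₂))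
    (ω : ℝ) (hω0 : 0 < ω)
    (hω : ω < (2 / L) * (eigMin Γ⁻¹ / (eigMax Γ⁻¹) ^ 2))
    (Λseq : ℕ → Matrix (Fin m_u) (Fin n) ℝ)
    (hinit : Λseq 0 ∈ S0 A Bu Ba Q R Γ Kbar Pu)
    (hstep : ∀ i, Λseq (i + 1) = Λseq i +
      ω • (-(Γ⁻¹ * (Buᵀ * Pu (Λseq i) * Pim (Λseq i))) - Λseq i)) :
    ∀ i : ℕ, Λseq i ∈ S0 A Bu Ba Q R Γ Kbar Pu ∧
      IsStabSol A Bu Ba Q R (Λseq i) (Pu (Λseq i)) ∧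
      IsLyapSol A Bu Ba R Kbar (Λseq i) (Pu (Λseq i)) (Pim (Λseq i)) ∧
      (∀ W, IsLyapSol A Bu Ba R Kbar (Λseq i) (Pu (Λseq i)) W → W = Pim (Λseq i)) := by
  have hm : 0 < m_u := pos_of_eigMin_ne_zero (M := Γ⁻¹) fun h => by
    rw [h, zero_div, mul_zero] at hω
    exact hω.not_gt hω0
  have hω' : L * ω * eigMax Γ⁻¹ ^ 2 < 2 * eigMin Γ⁻¹ := by
    have hb : eigMax Γ⁻¹ ≠ 0 := fun h => by
      rw [h, zero_pow two_ne_zero, div_zero, mul_zero] at hω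
      exact hω.not_gt hω0
    have hb2 : 0 < eigMax Γ⁻¹ ^ 2 := by positivity
    rw [div_mul_div_comm, lt_div_iff₀ (mul_pos hL hb2)] at hω
    linarith
  have hdet : IsUnit Γ.det := (isUnit_iff_isUnit_det Γ).mp hΓ.isUnit
  have hcert : ∀ (K : Matrix (Fin m_a) (Fin n) ℝ) (Λ : Matrix (Fin m_u) (Fin n) ℝ),
      frobNorm (K - Kbar) ^ 2 + trace (Λᵀ * Γ * Λ) ≤ Jcost Ba R Γ Kbar Pu 0 →
      ∀ x, x ⬝ᵥ ((A + Bu * Λ + Ba * K)ᵀ * S + S * (A + Bu * Λ + Ba * K)) *ᵥ x ≤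
        -(2 * (1 - ε)) * (x ⬝ᵥ x) := fun K Λ hK x =>
    closedLoop_certificate hS hε0 hΓ (eigMin_pos hm hΓ) hSeq hdist (by rwa [Jcost_zero] at hK) x
  have hδ : 0 < 1 - ε := sub_pos.mpr hε1
  have hmem : ∀ i, Λseq i ∈ S0 A Bu Ba Q R Γ Kbar Pu := by
    intro i
    induction i with
    | zero => exact hinit
    | succ i ih =>
      rw [hstep]
      refine step_mem_S0 hQ hR hΓ hS hδ hPu hPim hcert hL hLip hω0 hω' ih rfl ?_
      rw [Matrix.mul_smul, smul_smul, Matrix.mul_add, nonsing_inv_mul_cancel_left _ _ hdet]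
      norm_num
      abel
  intro i
  have hP := hPu _ (hmem i).1
  have hZ := hPim _ (hmem i).1
  exact ⟨hmem i, hP, hZ, fun W hW => hW.unique hP hZ⟩
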